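/- Let A be a p-group acting by automorphisms on a finite group G of p'-order, C = C_G(A), and C ≤ H ≤ G an A-invariant subgroup. For θ ∈ Irr_A(G), write θ_H = Σ a_η η over η ∈ Irr(H). Then there is exactly one A-invariant irreducible constituent φ of θ_H with a_φ ≢ 0 (mod p), and a_φ ≡ ±1 (mod p). -/

import Mathlib

attribute [local instance] Classical.propDecidable

/-- The usual inner product of class functions/characters on a finite group. -/
noncomputable def innerChar (G : Type*) [Group G] [Fintype G] (α β : G → ℂ) : ℂ :=
  (Fintype.card G : ℂ)⁻¹ * ∑ g : G, α g * (starRingEnd ℂ) (β g)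

/-- `χ : G → ℂ` is the character of some finite-dimensional complex representation. -/
def IsChar (G : Type) [Group G] [Fintype G] (χ : G → ℂ) : Prop :=
  ∃ V : FDRep ℂ G, FDRep.character V = χ

/-- `χ` is an irreducible complex character of `G`. -/
def IsIrrChar (G : Type) [Group G] [Fintype G] (χ : G → ℂ) : Prop :=
  IsChar G χ ∧ innerChar G χ χ = 1

/-- The unnormalised bilinear pairing `∑ g, α g * β g⁻¹` of functions on a finite group. -/
def charPairing {K R : Type*} [Group K] [Fintype K] [CommRing R] (α β : K → R) : R :=
  ∑ g : K, α g * β g⁻¹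

section Trace

open Module Module.End

theorem trace_pow_eq_sum_eigenvalues {V : Type*} [AddCommGroup V] [Module ℂ V]
    [FiniteDimensional ℂ V] {f : End ℂ V} {n : ℕ} (hn : n ≠ 0) (hf : f ^ n = 1) :
    ∃ (S : Finset ℂ) (d : ℂ → ℕ), (∀ μ ∈ S, μ ^ n = 1) ∧
      ∀ j : ℕ, LinearMap.trace ℂ V (f ^ j) = ∑ μ ∈ S, (d μ : ℂ) * μ ^ j := by
  have hss : f.IsSemisimple := by
    refine isSemisimple_of_squarefree_aeval_eq_zero (p := Polynomial.X ^ n - 1) ?_ (by simp [hf])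
    exact ((Polynomial.X_pow_sub_one_separable_iff).2 (by exact_mod_cast hn)).squarefree
  have hinternal : DirectSum.IsInternal (fun μ : ℂ => f.eigenspace μ) :=
    DirectSum.isInternal_submodule_of_iSupIndep_of_iSup_eq_top
      f.eigenspaces_iSupIndep hss.iSup_eigenspace_eq_top
  have hfin : {μ : ℂ | f.eigenspace μ ≠ ⊥}.Finite :=
    WellFoundedGT.finite_ne_bot_of_iSupIndep f.eigenspaces_iSupIndep
  have hpow : ∀ (j : ℕ) (μ : ℂ), ∀ v ∈ f.eigenspace μ, (f ^ j) v = μ ^ j • v := by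
    intro j μ v hv
    rw [mem_eigenspace_iff] at hv
    induction j with
    | zero => simp
    | succ j ih => rw [pow_succ', Module.End.mul_apply, ih, map_smul, hv, smul_smul, pow_succ]
  refine ⟨hfin.toFinset, fun μ => finrank ℂ (f.eigenspace μ), fun μ hμ => ?_, fun j => ?_⟩
  · obtain ⟨v, hv, hv0⟩ := (Submodule.ne_bot_iff _).1 (hfin.mem_toFinset.1 hμ)
    have h := hpow n μ v hv
    rw [hf, Module.End.one_apply] at h
    have h' : (1 - μ ^ n) • v = 0 := by rw [sub_smul, one_smul, ← h, sub_self]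
    exact (sub_eq_zero.1 ((smul_eq_zero.1 h').resolve_right hv0)).symm
  · have hmaps : ∀ μ, Set.MapsTo (f ^ j) (f.eigenspace μ) (f.eigenspace μ) := fun μ v hv => by
      rw [SetLike.mem_coe, hpow j μ v hv]
      exact Submodule.smul_mem _ _ hv
    rw [LinearMap.trace_eq_sum_trace_restrict' hinternal hfin hmaps]
    refine Finset.sum_congr rfl fun μ _ => ?_
    have : (f ^ j).restrict (hmaps μ) = μ ^ j • LinearMap.id := by
      ext v
      exact hpow j μ v v.2
    rw [this, map_smul, LinearMap.trace_id, smul_eq_mul, mul_comm]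

end Trace

section Characters

open Module CategoryTheory

variable {K : Type} [Group K] [Fintype K] {χ ψ : K → ℂ}

theorem FDRep.ρ_pow_card (V : FDRep ℂ K) (g : K) : V.ρ g ^ Fintype.card K = 1 := by
  rw [← map_pow, pow_card_eq_one, map_one]

theorem IsChar.isIntegral (hχ : IsChar K χ) (g : K) : IsIntegral ℤ (χ g) := by
  obtain ⟨V, rfl⟩ := hχ
  obtain ⟨S, d, hS, htr⟩ :=
    trace_pow_eq_sum_eigenvalues Fintype.card_ne_zero (FDRep.ρ_pow_card V g)
  have h := htr 1
  rw [pow_one] at h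
  rw [FDRep.character, h]
  refine IsIntegral.sum _ fun μ hμ => IsIntegral.mul ?_ ?_
  · simpa using isIntegral_algebraMap (R := ℤ) (A := ℂ) (x := (d μ : ℤ))
  · exact (IsIntegral.of_pow Fintype.card_pos (by rw [hS μ hμ]; exact isIntegral_one)).pow 1

theorem IsChar.map_inv (hχ : IsChar K χ) (g : K) : χ g⁻¹ = (starRingEnd ℂ) (χ g) := by
  obtain ⟨V, rfl⟩ := hχ
  obtain ⟨S, d, hS, htr⟩ :=
    trace_pow_eq_sum_eigenvalues Fintype.card_ne_zero (FDRep.ρ_pow_card V g)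
  have h1 := htr 1
  rw [pow_one] at h1
  have hinv : g⁻¹ = g ^ (Fintype.card K - 1) := by
    rw [inv_eq_iff_mul_eq_one, ← pow_succ', Nat.sub_add_cancel Fintype.card_pos, pow_card_eq_one]
  rw [FDRep.character, FDRep.character, h1, hinv, map_pow, htr, map_sum]
  refine Finset.sum_congr rfl fun μ hμ => ?_
  have hnorm : ‖μ‖ = 1 := Complex.norm_eq_one_of_pow_eq_one (hS μ hμ) Fintype.card_ne_zero
  rw [map_mul, map_natCast, pow_one, ← Complex.inv_eq_conj hnorm]
  congr 1
  refine eq_inv_of_mul_eq_one_left ?_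
  rw [← pow_succ, Nat.sub_add_cancel Fintype.card_pos, hS μ hμ]

theorem IsChar.map_conj (hχ : IsChar K χ) (g h : K) : χ (h * g * h⁻¹) = χ g := by
  obtain ⟨V, rfl⟩ := hχ
  exact V.char_conj g h

theorem IsChar.innerChar_eq (hψ : IsChar K ψ) :
    innerChar K χ ψ = (Fintype.card K : ℂ)⁻¹ * charPairing χ ψ := by
  simp only [innerChar, charPairing, hψ.map_inv]

theorem IsChar.charPairing_eq_iff (hψ : IsChar K ψ) {z : ℂ} :
    innerChar K χ ψ = z ↔ charPairing χ ψ = Fintype.card K * z := by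
  rw [hψ.innerChar_eq, inv_mul_eq_iff_eq_mul₀ (by exact_mod_cast Fintype.card_ne_zero)]

theorem IsChar.exists_innerChar_eq_natCast (hχ : IsChar K χ) (hψ : IsChar K ψ) :
    ∃ m : ℕ, innerChar K χ ψ = m := by
  rw [hψ.innerChar_eq]
  obtain ⟨V, rfl⟩ := hχ
  obtain ⟨W, rfl⟩ := hψ
  have := invertibleOfNonzero (NeZero.ne (Nat.card K : ℂ))
  rw [← Nat.card_eq_fintype_card]
  exact ⟨_, FDRep.scalar_product_char_eq_finrank_equivariant W V⟩

theorem IsChar.comp (hχ : IsChar K χ) {L : Type} [Group L] [Fintype L] (f : L →* K) :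
    IsChar L (χ ∘ f) := by
  obtain ⟨V, rfl⟩ := hχ
  exact ⟨FDRep.of (V.ρ.comp f), rfl⟩

theorem IsIrrChar.comp_mulEquiv (hχ : IsIrrChar K χ) (f : MulAut K) : IsIrrChar K (χ ∘ f) := by
  refine ⟨hχ.1.comp f.toMonoidHom, ?_⟩
  rw [← hχ.2, innerChar, innerChar]
  congr 1
  exact Equiv.sum_comp f.toEquiv fun g => χ g * (starRingEnd ℂ) (χ g)

theorem IsIrrChar.exists_simple (hχ : IsIrrChar K χ) :
    ∃ V : FDRep ℂ K, Simple V ∧ V.character = χ := by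
  obtain ⟨hχ, h1⟩ := hχ
  have h := hχ.charPairing_eq_iff.1 h1
  obtain ⟨V, rfl⟩ := hχ
  refine ⟨V, V.simple_iff_char_is_norm_one.2 ?_, rfl⟩
  rw [← Fintype.card_eq_nat_card]
  simpa [charPairing] using h

theorem IsIrrChar.charPairing_self (hχ : IsIrrChar K χ) :
    charPairing χ χ = (Fintype.card K : ℂ) := by
  simpa using hχ.1.charPairing_eq_iff.1 hχ.2

theorem IsIrrChar.charPairing_eq_zero (hχ : IsIrrChar K χ) (hψ : IsIrrChar K ψ) (h : χ ≠ ψ) :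
    charPairing χ ψ = 0 := by
  obtain ⟨V, hV, rfl⟩ := hχ.exists_simple
  obtain ⟨W, hW, rfl⟩ := hψ.exists_simple
  have := invertibleOfNonzero (NeZero.ne (Nat.card K : ℂ))
  have ho := FDRep.char_orthonormal V W
  rw [if_neg fun ⟨i⟩ => h (FDRep.char_iso i)] at ho
  exact (mul_eq_zero.1 ho).resolve_left (inv_ne_zero (NeZero.ne _))

/-- A class function acts on an irreducible representation by a scalar. -/
theorem IsIrrChar.convolution_eq (hχ : IsIrrChar K χ) {f : K → ℂ}
    (hf : ∀ g h, f (h * g * h⁻¹) = f g) (x : K) :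
    χ 1 * ∑ g, f g * χ (g⁻¹ * x) = charPairing f χ * χ x := by
  obtain ⟨V, hV, rfl⟩ := hχ.exists_simple
  let T : V →ₗ[ℂ] V := ∑ g, f g • V.ρ g⁻¹
  have hcomm : ∀ h, T ∘ₗ V.ρ h = V.ρ h ∘ₗ T := by
    intro h
    change T * V.ρ h = V.ρ h * T
    simp only [T, Finset.sum_mul, Finset.mul_sum, smul_mul_assoc, mul_smul_comm, ← map_mul]
    refine Fintype.sum_equiv (MulAut.conj h⁻¹).toEquiv _ _ fun g => ?_
    have : f ((MulAut.conj h⁻¹).toEquiv g) = f g := hf g h⁻¹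
    rw [this]
    simp [mul_assoc]
  obtain ⟨ω, hω⟩ : ∃ ω : ℂ, T = ω • LinearMap.id := by
    let F : Action.Hom V V := ⟨InducedCategory.homMk (ModuleCat.ofHom T), fun g => by
      ext1
      exact hcomm g⟩
    obtain ⟨ω, hω⟩ := endomorphism_simple_eq_smul_id ℂ (X := V) F
    exact ⟨ω, congrArg (fun F : V ⟶ V => F.hom.hom.hom) hω.symm⟩
  have htr : ∀ y, ∑ g, f g * V.character (g⁻¹ * y) = ω * V.character y := by
    intro y
    have h : LinearMap.trace ℂ V (T * V.ρ y) = ω * V.character y := by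
      rw [hω, smul_mul_assoc, map_smul, smul_eq_mul]
      rfl
    rw [← h]
    simp only [T, Finset.sum_mul, smul_mul_assoc, ← map_mul, map_sum, map_smul, smul_eq_mul]
    rfl
  have h1 := htr 1
  simp only [mul_one] at h1
  rw [htr, charPairing, h1]
  ring

end Characters

section Decomposition

open Module

variable {K : Type} [Group K] [Fintype K]

theorem Representation.isIrrChar_character {V : Type} [AddCommGroup V] [Module ℂ V]
    [FiniteDimensional ℂ V] (ρ : Representation ℂ K V) [ρ.IsIrreducible] :
    IsIrrChar K ρ.character := by
  have hχ : IsChar K ρ.character := ⟨FDRep.of ρ, rfl⟩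
  refine ⟨hχ, ?_⟩
  have := invertibleOfNonzero (NeZero.ne (Nat.card K : ℂ))
  have h := Representation.char_orthonormal ρ ρ
  rw [if_pos ⟨Representation.Equiv.refl ρ⟩, Nat.card_eq_fintype_card] at h
  rw [hχ.innerChar_eq]
  exact_mod_cast h

theorem Representation.exists_character_eq_sum (n : ℕ) :
    ∀ {V : Type} [AddCommGroup V] [Module ℂ V] [FiniteDimensional ℂ V]
      (ρ : Representation ℂ K V), finrank ℂ V = n →
      ∃ s : Multiset (K → ℂ), (∀ η ∈ s, IsIrrChar K η) ∧ ρ.character = s.sum := by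
  induction n using Nat.strong_induction_on with
  | _ n ih =>
    intro V _ _ _ ρ hn
    by_cases hirr : ρ.IsIrreducible
    · exact ⟨{ρ.character}, by simpa using ρ.isIrrChar_character, by simp⟩
    by_cases hV : Subsingleton V
    · refine ⟨0, by simp, ?_⟩
      ext g
      simp [Representation.character, Subsingleton.elim (ρ g) 0]
    rw [not_subsingleton_iff_nontrivial] at hV
    obtain ⟨σ, hσ0, hσ1⟩ : ∃ σ : Subrepresentation ρ, σ ≠ ⊥ ∧ σ ≠ ⊤ := by
      by_contra! h
      have : Nontrivial (Subrepresentation ρ) :=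
        ⟨⊥, ⊤, fun h => bot_ne_top (α := Submodule ℂ V) (congrArg (·.toSubmodule) h)⟩
      exact hirr ⟨fun σ => or_iff_not_imp_left.2 (h σ)⟩
    obtain ⟨τ, hστ⟩ := exists_isCompl σ
    have hτ1 : τ ≠ ⊤ := fun h => hσ0 (by simpa [h] using hστ.inf_eq_bot)
    have hlt : ∀ κ : Subrepresentation ρ, κ ≠ ⊤ → finrank ℂ κ.toSubmodule < n := fun κ hκ =>
      hn ▸ Submodule.finrank_lt fun h => hκ (Subrepresentation.toSubmodule_injective h)
    obtain ⟨s, hs, hsσ⟩ := ih _ (hlt σ hσ1) σ.toRepresentation rfl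
    obtain ⟨t, ht, htτ⟩ := ih _ (hlt τ hτ1) τ.toRepresentation rfl
    refine ⟨s + t, fun η hη => (Multiset.mem_add.1 hη).elim (hs η) (ht η), ?_⟩
    rw [Multiset.sum_add, ← hsσ, ← htτ]
    let N : Bool → Submodule ℂ V := fun b => (cond b σ τ).toSubmodule
    have hN : DirectSum.IsInternal N := by
      rw [DirectSum.isInternal_submodule_iff_isCompl N (i := true) (j := false) (by simp)
        (by ext b; cases b <;> simp)]
      exact IsCompl.of_eq (congrArg (·.toSubmodule) hστ.inf_eq_bot)
        (congrArg (·.toSubmodule) hστ.sup_eq_top)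
    ext g
    have hmaps : ∀ b, Set.MapsTo (ρ g) (N b) (N b) := fun b v hv =>
      (cond b σ τ).apply_mem_toSubmodule g hv
    rw [Representation.character, LinearMap.trace_eq_sum_trace_restrict hN hmaps, Fintype.sum_bool]
    rfl

theorem IsChar.exists_eq_sum {χ : K → ℂ} (hχ : IsChar K χ) :
    ∃ s : Multiset (K → ℂ), (∀ η ∈ s, IsIrrChar K η) ∧ χ = s.sum := by
  obtain ⟨V, rfl⟩ := hχ
  exact Representation.exists_character_eq_sum _ V.ρ rfl

end Decomposition

section FixedPoints

variable {p : ℕ} [Fact p.Prime] {A : Type*} [Group A] {k : Type*} [Field k]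

/-- Modulo `p`, a sum invariant under a `p`-group is the sum over the fixed points. -/
theorem IsPGroup.sum_eq_sum_fixedPoints [CharP k p] (hA : IsPGroup p A) {X : Type*} [Fintype X]
    (σ : A →* Equiv.Perm X) (F : X → k) (hF : ∀ a x, F (σ a x) = F x) :
    ∑ x, F x = ∑ x with ∀ a, σ a x = x, F x := by
  rw [← Finset.sum_fiberwise_of_maps_to (s := Finset.univ) (t := Finset.univ.image F) (g := F)
      (fun x _ => Finset.mem_image_of_mem F (Finset.mem_univ x)),
    ← Finset.sum_fiberwise_of_maps_to (s := {x | ∀ a, σ a x = x})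
      (t := Finset.univ.image F) (g := F)
      (fun x _ => Finset.mem_image_of_mem F (Finset.mem_univ x))]
  refine Finset.sum_congr rfl fun v _ => ?_
  rw [Finset.sum_congr rfl (g := fun _ => v) (by simp),
    Finset.sum_congr (s₁ := Finset.filter _ (Finset.filter _ _)) rfl (g := fun _ => v) (by simp),
    Finset.sum_const, Finset.sum_const, nsmul_eq_mul, nsmul_eq_mul]
  congr 1
  let _ : MulAction A {x // F x = v} :=
    { smul := fun a x => ⟨σ a x, (hF a x).trans x.2⟩
      one_smul := fun x => Subtype.ext (by change σ 1 x.1 = x.1; simp)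
      mul_smul := fun a b x => Subtype.ext (by change σ (a * b) x.1 = σ a (σ b x.1); simp) }
  have hfix : (Finset.filter (fun x => F x = v) {x | ∀ a, σ a x = x}).card =
      Nat.card (MulAction.fixedPoints A {x // F x = v}) := by
    rw [← Fintype.card_coe, ← Nat.card_eq_fintype_card]
    refine Nat.card_congr
      { toFun := fun x => ⟨⟨x, (Finset.mem_filter.1 x.2).2⟩, fun a => Subtype.ext ?_⟩
        invFun := fun x => ⟨x.1, Finset.mem_filter.2 ⟨Finset.mem_filter.2
          ⟨Finset.mem_univ _, fun a => congrArg Subtype.val (x.2 a)⟩, x.1.2⟩⟩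
        left_inv := fun _ => rfl
        right_inv := fun _ => rfl }
    exact (Finset.mem_filter.1 (Finset.mem_filter.1 x.2).1).2 a
  have h := hA.card_modEq_card_fixedPoints {x // F x = v}
  rw [← hfix, Nat.card_eq_fintype_card, Fintype.card_subtype] at h
  exact (CharP.cast_eq_iff_mod_eq k p).2 h

variable {K C : Type*} [Group K] [Fintype K] [Group C]

theorem IsPGroup.sum_eq_sum_of_range_eq [CharP k p] [Fintype C] (hA : IsPGroup p A)
    (σ : A →* MulAut K) {ι : C →* K}
    (hι : Function.Injective ι) (hC : ∀ g, g ∈ ι.range ↔ ∀ a, σ a g = g)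
    (F : K → k) (hF : ∀ a x, F (σ a x) = F x) : ∑ g, F g = ∑ c, F (ι c) := by
  rw [hA.sum_eq_sum_fixedPoints ((MulAut.toPerm K).comp σ) F hF]
  refine (Finset.sum_bij (fun c _ => ι c) (fun c _ => ?_) (fun _ _ _ _ h => hι h)
    (fun g hg => ?_) fun _ _ => rfl).symm
  · exact Finset.mem_filter.2 ⟨Finset.mem_univ _, (hC (ι c)).1 ⟨c, rfl⟩⟩
  · obtain ⟨c, hc⟩ := (hC g).2 (Finset.mem_filter.1 hg).2
    exact ⟨c, Finset.mem_univ _, hc⟩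

theorem IsPGroup.card_eq_card_of_range_eq [CharP k p] [Fintype C] (hA : IsPGroup p A)
    (σ : A →* MulAut K) {ι : C →* K}
    (hι : Function.Injective ι) (hC : ∀ g, g ∈ ι.range ↔ ∀ a, σ a g = g) :
    (Fintype.card K : k) = Fintype.card C := by
  simpa using hA.sum_eq_sum_of_range_eq (k := k) σ hι hC (fun _ => 1) fun _ _ => rfl

/-- Elements of the fixed-point subgroup conjugate in the whole group are conjugate in the
fixed-point subgroup, for coprime action of a `p`-group. -/
theorem IsPGroup.isConj_of_isConj_map (hA : IsPGroup p A) (σ : A →* MulAut K) {ι : C →* K}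
    (hι : Function.Injective ι) (hC : ∀ g, g ∈ ι.range ↔ ∀ a, σ a g = g)
    (hK : ¬ p ∣ Fintype.card K) {c d : C} (h : IsConj (ι c) (ι d)) : IsConj c d := by
  have hfix : ∀ c a, σ a (ι c) = ι c := fun c => (hC (ι c)).1 ⟨c, rfl⟩
  let _ : MulAction A {x : K // x * ι c * x⁻¹ = ι d} :=
    { smul := fun a x => ⟨σ a x, by
        simpa [hfix] using congrArg (σ a) x.2⟩
      one_smul := fun x => Subtype.ext (by change σ 1 x.1 = x.1; simp)
      mul_smul := fun a b x => Subtype.ext (by change σ (a * b) x.1 = σ a (σ b x.1); simp) }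
  obtain ⟨y, hy⟩ := isConj_iff.1 h
  have hcard : Nat.card {x : K // x * ι c * x⁻¹ = ι d} =
      Nat.card (Subgroup.centralizer {ι c}) := by
    refine Nat.card_congr ((Equiv.mulLeft y⁻¹).subtypeEquiv fun x => ?_)
    rw [Subgroup.mem_centralizer_singleton_iff, ← hy]
    simp only [Equiv.coe_mulLeft]
    constructor
    · intro h
      rw [mul_inv_eq_iff_eq_mul] at h
      rw [mul_assoc, h]
      group
    · intro h
      rw [mul_inv_eq_iff_eq_mul]
      calc x * ι c = y * (y⁻¹ * x * ι c) := by group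
        _ = _ := by rw [h]; group
  have hdvd : ¬ p ∣ Nat.card {x : K // x * ι c * x⁻¹ = ι d} := by
    rw [hcard]
    intro h'
    exact hK (h'.trans (Nat.card_eq_fintype_card (α := K) ▸ Subgroup.card_subgroup_dvd_card _))
  obtain ⟨x, hx⟩ := hA.nonempty_fixed_point_of_prime_not_dvd_card _ hdvd
  obtain ⟨e, he⟩ := (hC x.1).2 fun a => congrArg Subtype.val (hx a)
  refine isConj_iff.2 ⟨e, hι ?_⟩
  rw [map_mul, map_mul, map_inv, he, x.2]

theorem IsPGroup.exists_classFunction_extension (hA : IsPGroup p A) (σ : A →* MulAut K)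
    {ι : C →* K} (hι : Function.Injective ι) (hC : ∀ g, g ∈ ι.range ↔ ∀ a, σ a g = g)
    (hK : ¬ p ∣ Fintype.card K) (f : C → k) (hf : ∀ c e, f (e * c * e⁻¹) = f c) :
    ∃ X : K → k, (∀ g h, X (h * g * h⁻¹) = X g) ∧ (∀ a g, X (σ a g) = X g) ∧
      ∀ c, X (ι c) = f c := by
  have hconj : ∀ c d, IsConj (ι c) (ι d) → f c = f d := fun c d h => by
    obtain ⟨e, rfl⟩ := isConj_iff.1 (hA.isConj_of_isConj_map σ hι hC hK h)
    exact (hf c e).symm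
  let X : K → k := fun g => if h : ∃ c, IsConj (ι c) g then f h.choose else 0
  have hX : ∀ c g, IsConj (ι c) g → X g = f c := fun c g h => by
    have h' : ∃ c, IsConj (ι c) g := ⟨c, h⟩
    simp only [X, dif_pos h']
    exact hconj _ _ (h'.choose_spec.trans h.symm)
  have hX' : ∀ g g', (∀ c, IsConj (ι c) g ↔ IsConj (ι c) g') → X g' = X g := fun g g' h => by
    by_cases hg : ∃ c, IsConj (ι c) g
    · obtain ⟨c, hc⟩ := hg
      rw [hX c g hc, hX c g' ((h c).1 hc)]
    · simp only [X, dif_neg hg]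
      rw [dif_neg fun ⟨c, hc⟩ => hg ⟨c, (h c).2 hc⟩]
  refine ⟨X, fun g h => hX' _ _ fun c => ?_, fun a g => hX' _ _ fun c => ?_,
    fun c => hX c _ (IsConj.refl _)⟩
  · have hgh : IsConj g (h * g * h⁻¹) := isConj_iff.2 ⟨h, rfl⟩
    exact ⟨fun hc => hc.trans hgh, fun hc => hc.trans hgh.symm⟩
  · have hfix : ∀ a, σ a (ι c) = ι c := (hC (ι c)).1 ⟨c, rfl⟩
    have hmap : ∀ a g, IsConj (ι c) g → IsConj (ι c) (σ a g) := fun a g hc => by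
      have h := (σ a).toMonoidHom.map_isConj hc
      change IsConj (σ a (ι c)) (σ a g) at h
      rwa [hfix] at h
    refine ⟨hmap a g, fun hc => ?_⟩
    simpa using hmap a⁻¹ _ hc

theorem IsPGroup.charPairing_comp (hA : IsPGroup p A) [CharP k p] [Fintype C] (σ : A →* MulAut K)
    {ι : C →* K} (hι : Function.Injective ι) (hC : ∀ g, g ∈ ι.range ↔ ∀ a, σ a g = g)
    {α β : K → k} (hα : ∀ a g, α (σ a g) = α g) (hβ : ∀ a g, β (σ a g) = β g) :
    charPairing α β = charPairing (α ∘ ι) (β ∘ ι) := by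
  rw [charPairing, hA.sum_eq_sum_of_range_eq σ hι hC _ fun a g => by rw [← map_inv, hα, hβ]]
  simp [charPairing]

end FixedPoints

section Reduction

theorem exists_residue_field (p : ℕ) [Fact p.Prime] :
    ∃ (k : Type) (_ : Field k) (_ : CharP k p) (π : integralClosure ℤ ℂ →+* k),
      Function.Surjective π := by
  have hmax : (Ideal.span {(p : ℤ)}).IsMaximal :=
    PrincipalIdealRing.isMaximal_of_irreducible
      (Nat.prime_iff_prime_int.1 Fact.out).irreducible
  obtain ⟨Q, hQ, hQp⟩ := Ideal.exists_ideal_over_maximal_of_isIntegral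
    (S := integralClosure ℤ ℂ) (Ideal.span {(p : ℤ)}) (by
      rw [(RingHom.injective_iff_ker_eq_bot _).1
        (FaithfulSMul.algebraMap_injective ℤ (integralClosure ℤ ℂ))]
      exact bot_le)
  let _ := Ideal.Quotient.field Q
  refine ⟨integralClosure ℤ ℂ ⧸ Q, inferInstance, ?_, Ideal.Quotient.mk Q,
    Ideal.Quotient.mk_surjective⟩
  rw [CharP.charP_iff_prime_eq_zero Fact.out, ← map_natCast (Ideal.Quotient.mk Q),
    Ideal.Quotient.eq_zero_iff_mem]
  have h : (p : ℤ) ∈ Q.comap (algebraMap ℤ (integralClosure ℤ ℂ)) :=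
    hQp ▸ Ideal.mem_span_singleton_self _
  simpa using h

variable {K : Type} [Group K] [Fintype K]

/-- The character with integral values `χ`, viewed with complex values. -/
abbrev complexValued (χ : K → integralClosure ℤ ℂ) : K → ℂ := fun g => χ g

theorem IsChar.exists_lift {χ : K → ℂ} (hχ : IsChar K χ) :
    ∃ χ' : K → integralClosure ℤ ℂ, complexValued χ' = χ :=
  ⟨fun g => ⟨χ g, hχ.isIntegral g⟩, rfl⟩

theorem coe_charPairing (α β : K → integralClosure ℤ ℂ) :
    ((charPairing α β : integralClosure ℤ ℂ) : ℂ) =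
      charPairing (complexValued α) (complexValued β) := by
  simp [charPairing]

variable {p : ℕ} [Fact p.Prime] {k : Type*} [Field k] (π : integralClosure ℤ ℂ →+* k)

theorem map_charPairing (α β : K → integralClosure ℤ ℂ) :
    π (charPairing α β) = charPairing (π ∘ α) (π ∘ β) := by
  simp [charPairing]

theorem charPairing_reduction_eq {α β : K → integralClosure ℤ ℂ} {m : ℕ}
    (h : charPairing (complexValued α) (complexValued β) = Fintype.card K * (m : ℂ)) :
    charPairing (π ∘ α) (π ∘ β) = Fintype.card K * (m : k) := by
  have h' : charPairing α β = Fintype.card K * (m : integralClosure ℤ ℂ) := by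
    apply Subtype.val_injective
    rw [coe_charPairing, h]
    simp
  rw [← map_charPairing, h']
  simp

section Irreducible

variable {χ : K → integralClosure ℤ ℂ} (hχ : IsIrrChar K (complexValued χ))
include hχ

theorem charPairing_reduction_self : charPairing (π ∘ χ) (π ∘ χ) = (Fintype.card K : k) := by
  simpa using charPairing_reduction_eq π (m := 1) (by simpa using hχ.charPairing_self)

theorem reduction_map_conj (g h : K) : (π ∘ χ) (h * g * h⁻¹) = (π ∘ χ) g :=
  congrArg π (Subtype.val_injective (hχ.1.map_conj g h))

variable {π} in
theorem reduction_convolution_eq (hπ : Function.Surjective π) {f : K → k}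
    (hf : ∀ g h, f (h * g * h⁻¹) = f g) (x : K) :
    π (χ 1) * ∑ g, f g * π (χ (g⁻¹ * x)) = charPairing f (π ∘ χ) * π (χ x) := by
  obtain ⟨s, hs⟩ := hπ.hasRightInverse
  have h : χ 1 * ∑ g, s (f g) * χ (g⁻¹ * x) = charPairing (s ∘ f) χ * χ x := by
    apply Subtype.val_injective
    have h := hχ.convolution_eq (f := complexValued (s ∘ f))
      (fun g h => by simp [complexValued, hf]) x
    simpa [coe_charPairing, complexValued, Function.comp_def] using h
  have hsf : π ∘ s ∘ f = f := funext fun g => hs (f g)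
  simpa [map_charPairing, hsf, hs (f _)] using congrArg π h

theorem reduction_map_one_ne_zero (hπ : Function.Surjective π) (hK : (Fintype.card K : k) ≠ 0) :
    π (χ 1) ≠ 0 := by
  intro h1
  have hself := charPairing_reduction_self π hχ
  have hzero : ∀ x, π (χ x) = 0 := fun x => by
    have h := reduction_convolution_eq hχ hπ (reduction_map_conj π hχ) x
    rw [h1, zero_mul, hself] at h
    exact (mul_eq_zero.1 h.symm).resolve_left hK
  apply hK
  rw [← hself]
  simp [charPairing, hzero]

variable {π} in
theorem IsPGroup.reduction_convolution_eq {A C : Type*} [Group A] [Group C] [Fintype C]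
    [CharP k p] (hA : IsPGroup p A) (σ : A →* MulAut K) {ι : C →* K}
    (hι : Function.Injective ι) (hC : ∀ g, g ∈ ι.range ↔ ∀ a, σ a g = g)
    (hK : ¬ p ∣ Fintype.card K) (hπ : Function.Surjective π)
    (hχA : ∀ a g, χ (σ a g) = χ g)
    {f : C → k} (hf : ∀ c e, f (e * c * e⁻¹) = f c) (x : C) :
    π (χ 1) * ∑ c, f c * π (χ (ι (c⁻¹ * x))) = charPairing f (π ∘ χ ∘ ι) * π (χ (ι x)) := by
  obtain ⟨X, hX, hXA, hXf⟩ := hA.exists_classFunction_extension σ hι hC hK f hf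
  have h := _root_.reduction_convolution_eq hχ hπ hX (ι x)
  have hfix : ∀ a, σ a (ι x) = ι x := (hC (ι x)).1 ⟨x, rfl⟩
  rw [hA.charPairing_comp σ hι hC hXA fun a g => congrArg π (hχA a g),
    hA.sum_eq_sum_of_range_eq σ hι hC _ fun a g => by
      rw [hXA, ← map_inv, ← hχA a (g⁻¹ * ι x), map_mul, hfix]] at h
  simpa [hXf, funext hXf, Function.comp_def] using h

end Irreducible

end Reduction

section Comparison

theorem charPairing_comm {K R : Type*} [Group K] [Fintype K] [CommRing R] (α β : K → R) :
    charPairing α β = charPairing β α :=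
  Fintype.sum_equiv (Equiv.inv K) _ _ fun g => by simp [mul_comm]

theorem charPairing_smul_left {K R : Type*} [Group K] [Fintype K] [CommRing R] (c : R)
    (α β : K → R) : charPairing (c • α) β = c * charPairing α β := by
  simp [charPairing, Finset.mul_sum, mul_assoc]

theorem sum_mul_inv_mul_comm {K R : Type*} [Group K] [Fintype K] [CommRing R] {α β : K → R}
    (hα : ∀ g h, α (h * g * h⁻¹) = α g) (x : K) :
    ∑ g, α g * β (g⁻¹ * x) = ∑ g, β g * α (g⁻¹ * x) :=
  Fintype.sum_equiv ((Equiv.inv K).trans (Equiv.mulRight x)) _ _ fun g => by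
    have h := hα (x⁻¹ * g * x) x
    simp only [Equiv.trans_apply, Equiv.inv_apply, Equiv.coe_mulRight, mul_inv_rev, inv_inv]
    rw [mul_comm, ← h]
    group

variable {p : ℕ} [Fact p.Prime] {A : Type*} [Group A]

theorem IsPGroup.exists_reduction_eq_mul {k : Type*} [Field k] [CharP k p]
    {π : integralClosure ℤ ℂ →+* k} (hπ : Function.Surjective π) (hA : IsPGroup p A)
    {G H : Type} [Group G] [Fintype G] [Group H] [Fintype H] {C : Type*} [Group C] [Fintype C]
    (σ : A →* MulAut G) {ι : C →* G} (hι : Function.Injective ι)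
    (hC : ∀ g, g ∈ ι.range ↔ ∀ a, σ a g = g) (hG : ¬ p ∣ Fintype.card G)
    (τ : A →* MulAut H) {κ : C →* H} (hκ : Function.Injective κ)
    (hD : ∀ g, g ∈ κ.range ↔ ∀ a, τ a g = g) (hH : ¬ p ∣ Fintype.card H)
    {χ : G → integralClosure ℤ ℂ} (hχ : IsIrrChar G (complexValued χ))
    (hχA : ∀ a g, χ (σ a g) = χ g)
    {ψ : H → integralClosure ℤ ℂ} (hψ : IsIrrChar H (complexValued ψ))
    (hψA : ∀ a g, ψ (τ a g) = ψ g)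
    (hne : charPairing (π ∘ χ ∘ ι) (π ∘ ψ ∘ κ) ≠ 0) :
    ∃ c : k, π ∘ χ ∘ ι = c • (π ∘ ψ ∘ κ) := by
  have hχC : ∀ g h, (π ∘ χ ∘ ι) (h * g * h⁻¹) = (π ∘ χ ∘ ι) g := fun g h => by
    simpa using reduction_map_conj π hχ (ι g) (ι h)
  have hψC : ∀ g h, (π ∘ ψ ∘ κ) (h * g * h⁻¹) = (π ∘ ψ ∘ κ) g := fun g h => by
    simpa using reduction_map_conj π hψ (κ g) (κ h)
  have h1 : π (ψ 1) ≠ 0 := reduction_map_one_ne_zero π hψ hπ fun h =>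
    hH ((CharP.cast_eq_zero_iff k p _).1 h)
  refine ⟨π (χ 1) / π (ψ 1), funext fun x => ?_⟩
  have e1 := hA.reduction_convolution_eq hχ σ hι hC hG hπ hχA hψC x
  have e2 := hA.reduction_convolution_eq hψ τ hκ hD hH hπ hψA hχC x
  have e3 := sum_mul_inv_mul_comm (β := π ∘ χ ∘ ι) hψC x
  rw [charPairing_comm] at e1
  simp only [Function.comp_apply, Pi.smul_apply, smul_eq_mul] at e1 e2 e3 ⊢
  rw [e3] at e1
  rw [div_mul_eq_mul_div, eq_div_iff h1]
  apply mul_left_cancel₀ hne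
  linear_combination π (χ 1) * e2 - π (ψ 1) * e1

end Comparison

section Constituents

variable {K : Type} [Group K] [Fintype K]

theorem innerChar_comp_mulEquiv (χ ψ : K → ℂ) (f : MulAut K) :
    innerChar K (χ ∘ f) (ψ ∘ f) = innerChar K χ ψ :=
  congrArg ((Fintype.card K : ℂ)⁻¹ * ·) (Fintype.sum_equiv f.toEquiv _ _ fun _ => rfl)

theorem innerChar_multiset_sum (s : Multiset (K → ℂ)) (ψ : K → ℂ) :
    innerChar K s.sum ψ = (s.map fun η => innerChar K η ψ).sum := by
  induction s using Multiset.induction_on with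
  | empty => simp [innerChar]
  | cons η s ih =>
    rw [Multiset.map_cons, Multiset.sum_cons, Multiset.sum_cons, ← ih]
    simp [innerChar, add_mul, Finset.sum_add_distrib, mul_add]

theorem IsChar.innerChar_comm {χ ψ : K → ℂ} (hχ : IsChar K χ) (hψ : IsChar K ψ) :
    innerChar K χ ψ = innerChar K ψ χ := by
  rw [hψ.innerChar_eq, hχ.innerChar_eq, charPairing_comm]

theorem IsIrrChar.innerChar_multiset_sum {ψ : K → ℂ} (hψ : IsIrrChar K ψ)
    {s : Multiset (K → ℂ)} (hs : ∀ η ∈ s, IsIrrChar K η) :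
    innerChar K s.sum ψ = s.count ψ := by
  rw [_root_.innerChar_multiset_sum, Finset.sum_multiset_map_count]
  rw [Finset.sum_eq_single ψ]
  · simp [hψ.2]
  · intro η hη hne
    rw [hψ.1.innerChar_eq, (hs η (Multiset.mem_toFinset.1 hη)).charPairing_eq_zero hψ hne]
    simp
  · intro h
    simp [Multiset.count_eq_zero.2 fun h' => h (Multiset.mem_toFinset.2 h')]

theorem innerChar_self_eq_sum_count_sq {s : Multiset (K → ℂ)} (hs : ∀ η ∈ s, IsIrrChar K η)
    (hsum : IsChar K s.sum) :
    innerChar K s.sum s.sum = ∑ η : s.toFinset, (s.count η.1 : ℂ) ^ 2 := by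
  rw [innerChar_multiset_sum, Finset.sum_multiset_map_count,
    Finset.sum_coe_sort s.toFinset fun η => (s.count η : ℂ) ^ 2]
  refine Finset.sum_congr rfl fun η hη => ?_
  have hη := hs η (Multiset.mem_toFinset.1 hη)
  rw [hη.1.innerChar_comm hsum, hη.innerChar_multiset_sum hs, nsmul_eq_mul, sq]

variable {p : ℕ} [Fact p.Prime] {A : Type*} [Group A]

theorem IsPGroup.exists_invariant_constituent (hA : IsPGroup p A) (σ : A →* MulAut K)
    {χ : K → ℂ} (hχ : IsChar K χ) (hχA : ∀ a g, χ (σ a g) = χ g) {n : ℕ}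
    (hn : innerChar K χ χ = n) (hpn : ¬ p ∣ n) :
    ∃ φ, IsIrrChar K φ ∧ (∀ a g, φ (σ a g) = φ g) ∧
      ∃ m : ℕ, innerChar K χ φ = m ∧ ¬ p ∣ m := by
  obtain ⟨s, hs, rfl⟩ := hχ.exists_eq_sum
  have hcount : ∀ a, ∀ η ∈ s, s.count (η ∘ σ a) = s.count η := fun a η hη => by
    have h := innerChar_comp_mulEquiv s.sum η (σ a)
    rw [show s.sum ∘ σ a = s.sum from funext (hχA a),
      ((hs η hη).comp_mulEquiv (σ a)).innerChar_multiset_sum hs,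
      (hs η hη).innerChar_multiset_sum hs] at h
    exact_mod_cast h
  let _ : MulAction A s.toFinset :=
    { smul a η := ⟨η.1 ∘ σ a⁻¹, by
        have hη := Multiset.mem_toFinset.1 η.2
        rw [Multiset.mem_toFinset, ← Multiset.count_pos, hcount _ _ hη]
        exact Multiset.count_pos.2 hη⟩
      one_smul η := Subtype.ext (funext fun g => show η.1 (σ 1⁻¹ g) = η.1 g by simp)
      mul_smul a b η := Subtype.ext (funext fun g =>
        show η.1 (σ (a * b)⁻¹ g) = η.1 (σ b⁻¹ (σ a⁻¹ g)) by
          rw [mul_inv_rev, map_mul, MulAut.mul_apply]) }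
  have hsum : ((∑ η : s.toFinset, s.count η.1 ^ 2 : ℕ) : ZMod p) ≠ 0 := by
    rw [Ne, ZMod.natCast_eq_zero_iff]
    rw [innerChar_self_eq_sum_count_sq hs hχ] at hn
    rwa [show ∑ η : s.toFinset, s.count η.1 ^ 2 = n by exact_mod_cast hn]
  push_cast at hsum
  rw [hA.sum_eq_sum_fixedPoints (MulAction.toPermHom A s.toFinset)
    (fun η => (s.count η.1 : ZMod p) ^ 2) fun a η => congrArg (fun i : ℕ => (i : ZMod p) ^ 2)
      (hcount a⁻¹ η.1 (Multiset.mem_toFinset.1 η.2))] at hsum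
  obtain ⟨η, hη, hne⟩ := Finset.exists_ne_zero_of_sum_ne_zero hsum
  have hη' := hs η.1 (Multiset.mem_toFinset.1 η.2)
  refine ⟨η.1, hη', fun a g => ?_, s.count η.1, hη'.innerChar_multiset_sum hs, fun h => ?_⟩
  · have h : η.1 ∘ σ a⁻¹⁻¹ = η.1 := congrArg Subtype.val ((Finset.mem_filter.1 hη).2 a⁻¹)
    rw [inv_inv] at h
    exact congrFun h g
  · exact hne (by simp [(ZMod.natCast_eq_zero_iff _ _).2 h])

end Constituents

section Restriction

variable {p : ℕ} [Fact p.Prime] {A : Type*} [Group A] {G H : Type} [Group G] [Fintype G]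
  [Group H] [Fintype H] {C : Type*} [Group C] [Fintype C]

theorem IsPGroup.exists_unique_constituent (hA : IsPGroup p A)
    (σ : A →* MulAut G) {ι : C →* G} (hι : Function.Injective ι)
    (hC : ∀ g, g ∈ ι.range ↔ ∀ a, σ a g = g) (hG : ¬ p ∣ Fintype.card G)
    (τ : A →* MulAut H) {κ : C →* H} (hκ : Function.Injective κ)
    (hD : ∀ g, g ∈ κ.range ↔ ∀ a, τ a g = g) (hH : ¬ p ∣ Fintype.card H)
    (j : H →* G) (hj : ∀ a h, j (τ a h) = σ a (j h)) (hjκ : ∀ c, j (κ c) = ι c)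
    {θ : G → ℂ} (hθ : IsIrrChar G θ) (hθA : ∀ a g, θ (σ a g) = θ g) :
    ∃ φ : H → ℂ,
      (IsIrrChar H φ ∧ (∀ a h, φ (τ a h) = φ h) ∧
        ∃ m : ℕ, innerChar H (θ ∘ j) φ = m ∧ ¬ p ∣ m ∧
          ((m : ZMod p) = 1 ∨ (m : ZMod p) = -1)) ∧
      ∀ φ' : H → ℂ, IsIrrChar H φ' → (∀ a h, φ' (τ a h) = φ' h) →
        (∃ m : ℕ, innerChar H (θ ∘ j) φ' = m ∧ ¬ p ∣ m) → φ' = φ := by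
  obtain ⟨k, _, _, π, hπ⟩ := exists_residue_field p
  have hθj : IsChar H (θ ∘ j) := hθ.1.comp j
  have hθjA : ∀ a h, (θ ∘ j) (τ a h) = (θ ∘ j) h := fun a h => by simp [hj, hθA]
  obtain ⟨χ, rfl⟩ := hθ.1.exists_lift
  have hχA : ∀ a g, χ (σ a g) = χ g := fun a g => Subtype.val_injective (hθA a g)
  have hcardG : (Fintype.card G : k) = Fintype.card C := hA.card_eq_card_of_range_eq σ hι hC
  have hcardH : (Fintype.card H : k) = Fintype.card C := hA.card_eq_card_of_range_eq τ hκ hD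
  have hcard : (Fintype.card C : k) ≠ 0 := by
    rwa [← hcardG, Ne, CharP.cast_eq_zero_iff k p]
  have hχπ : ∀ a g, (π ∘ χ) (σ a g) = (π ∘ χ) g := fun a g => congrArg π (hχA a g)
  have hself : charPairing (π ∘ χ ∘ ι) (π ∘ χ ∘ ι) = (Fintype.card C : k) := by
    rw [← hcardG, ← charPairing_reduction_self π hθ]
    exact (hA.charPairing_comp σ hι hC hχπ hχπ).symm
  have hjχ : ∀ a h, (π ∘ χ ∘ j) (τ a h) = (π ∘ χ ∘ j) h := fun a h => by simp [hj, hχA]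
  have hκχ : (π ∘ χ ∘ j) ∘ κ = π ∘ χ ∘ ι := funext fun c => by simp [hjκ]
  have hself' : charPairing (π ∘ χ ∘ j) (π ∘ χ ∘ j) = (Fintype.card C : k) := by
    rw [hA.charPairing_comp τ hκ hD hjχ hjχ, hκχ, hself]
  have key : ∀ ψ : H → integralClosure ℤ ℂ, IsIrrChar H (complexValued ψ) →
      (∀ a h, ψ (τ a h) = ψ h) → ∀ m : ℕ,
      innerChar H (complexValued χ ∘ j) (complexValued ψ) = m → ¬ p ∣ m →
        π ∘ χ ∘ ι = (m : k) • (π ∘ ψ ∘ κ) ∧ (m : k) ^ 2 = 1 := by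
    intro ψ hψ hψA m hm hpm
    have hψπ : ∀ a h, (π ∘ ψ) (τ a h) = (π ∘ ψ) h := fun a h => congrArg π (hψA a h)
    have hm' : (m : k) ≠ 0 := fun h => hpm ((CharP.cast_eq_zero_iff k p _).1 h)
    have hpair : charPairing (π ∘ χ ∘ ι) (π ∘ ψ ∘ κ) = Fintype.card C * (m : k) := by
      rw [← hcardH, ← charPairing_reduction_eq π (α := χ ∘ j) (β := ψ)
        (hψ.1.charPairing_eq_iff.1 hm), ← hκχ]
      exact (hA.charPairing_comp τ hκ hD hjχ hψπ).symm
    have hψself : charPairing (π ∘ ψ ∘ κ) (π ∘ ψ ∘ κ) = (Fintype.card C : k) := by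
      rw [← hcardH, ← charPairing_reduction_self π hψ]
      exact (hA.charPairing_comp τ hκ hD hψπ hψπ).symm
    obtain ⟨c, hc⟩ := hA.exists_reduction_eq_mul hπ σ hι hC hG τ hκ hD hH hθ hχA hψ hψA
      (by rw [hpair]; exact mul_ne_zero hcard hm')
    have hcm : c = m := by
      rw [hc, charPairing_smul_left, hψself, mul_comm] at hpair
      exact mul_left_cancel₀ hcard hpair
    subst hcm
    refine ⟨hc, mul_left_cancel₀ hcard ?_⟩
    rw [hc, charPairing_smul_left, charPairing_comm, charPairing_smul_left, hψself] at hself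
    linear_combination hself
  obtain ⟨n, hn⟩ := hθj.exists_innerChar_eq_natCast hθj
  have hpn : ¬ p ∣ n := fun h => by
    have e := charPairing_reduction_eq π (α := χ ∘ j) (β := χ ∘ j)
      (hθj.charPairing_eq_iff.1 hn)
    rw [(CharP.cast_eq_zero_iff k p n).2 h, mul_zero] at e
    exact hcard (hself'.symm.trans e)
  obtain ⟨φ, hφ, hφA, m, hm, hpm⟩ := hA.exists_invariant_constituent τ hθj hθjA hn hpn
  obtain ⟨ψ, rfl⟩ := hφ.1.exists_lift
  have hψA : ∀ a h, ψ (τ a h) = ψ h := fun a h => Subtype.val_injective (hφA a h)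
  obtain ⟨h1, h2⟩ := key ψ hφ hψA m hm hpm
  refine ⟨_, ⟨hφ, hφA, m, hm, hpm, ?_⟩, ?_⟩
  · rw [← mul_self_eq_one_iff, ← sq]
    exact (ZMod.castHom dvd_rfl k).injective (by simpa using h2)
  · rintro φ' hφ' hφ'A ⟨m', hm', hpm'⟩
    obtain ⟨ψ', rfl⟩ := hφ'.1.exists_lift
    have hψ'A : ∀ a h, ψ' (τ a h) = ψ' h := fun a h => Subtype.val_injective (hφ'A a h)
    obtain ⟨h1', h2'⟩ := key ψ' hφ' hψ'A m' hm' hpm'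
    by_contra hne
    have hzero : charPairing (π ∘ ψ') (π ∘ ψ) = Fintype.card H * ((0 : ℕ) : k) :=
      charPairing_reduction_eq π (by simpa using hφ'.charPairing_eq_zero hφ hne)
    rw [hA.charPairing_comp τ hκ hD (fun a h => congrArg π (hψ'A a h))
      fun a h => congrArg π (hψA a h)] at hzero
    rw [h1', charPairing_smul_left, charPairing_comm, ← h1', h1, charPairing_smul_left,
      charPairing_comm] at hself
    apply hcard
    rw [← hself]
    simp only [Function.comp_assoc, Nat.cast_zero, mul_zero] at hzero
    rw [hzero]
    simp

end Restriction

theorem stmt_13 {G A : Type} [Group G] [Fintype G] [Group A] [Fintype A]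
    (p : ℕ) (hp : p.Prime) (hA : IsPGroup p A) (hpG : ¬ p ∣ Fintype.card G)
    (ρ : A →* MulAut G)
    (C : Subgroup G) (hC : ∀ g : G, g ∈ C ↔ ∀ a : A, ρ a g = g)
    (H : Subgroup G) (hCH : C ≤ H) (hHinv : ∀ a : A, ∀ g ∈ H, ρ a g ∈ H)
    (θ : G → ℂ) (hθ : IsIrrChar G θ) (hθA : ∀ a : A, ∀ g : G, θ (ρ a g) = θ g) :
    ∃ φ : ↥H → ℂ,
      (IsIrrChar ↥H φ ∧
        (∀ a : A, ∀ h : ↥H, φ ⟨ρ a ↑h, hHinv a ↑h h.2⟩ = φ h) ∧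
        ∃ m : ℕ, innerChar ↥H (fun h => θ ↑h) φ = m ∧ ¬ p ∣ m ∧
          ((m : ZMod p) = 1 ∨ (m : ZMod p) = -1)) ∧
      ∀ φ' : ↥H → ℂ, IsIrrChar ↥H φ' →
        (∀ a : A, ∀ h : ↥H, φ' ⟨ρ a ↑h, hHinv a ↑h h.2⟩ = φ' h) →
        (∃ m : ℕ, innerChar ↥H (fun h => θ ↑h) φ' = m ∧ ¬ p ∣ m) → φ' = φ := by
  have : Fact p.Prime := ⟨hp⟩
  let τ : A →* MulAut H :=
    { toFun a :=
        { toFun h := ⟨ρ a h, hHinv a h h.2⟩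
          invFun h := ⟨ρ a⁻¹ h, hHinv a⁻¹ h h.2⟩
          left_inv h := Subtype.ext (by simp)
          right_inv h := Subtype.ext (by simp)
          map_mul' g h := Subtype.ext (by simp) }
      map_one' := by ext; simp
      map_mul' a b := by ext; simp }
  have hpH : ¬ p ∣ Fintype.card H := fun h => hpG (by
    rw [← Nat.card_eq_fintype_card] at h ⊢
    exact h.trans H.card_subgroup_dvd_card)
  exact hA.exists_unique_constituent ρ (ι := C.subtype) C.subtype_injective
    (by simpa using hC) hpG τ (κ := Subgroup.inclusion hCH) (Subgroup.inclusion_injective hCH)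
    (fun h => by
      rw [Subgroup.inclusion_range, Subgroup.mem_subgroupOf, hC]
      exact forall_congr' fun _ => ⟨fun e => Subtype.ext e, congrArg Subtype.val⟩)
    hpH H.subtype (fun _ _ => rfl) (fun _ => rfl) hθ hθA
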